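/- For every finite set Γ ∪ {α} of formulas: Γ ⊨_TML α if and only if for every valuation v into M4m, whenever v(γ) ∈ D for all γ ∈ Γ, also v(α) ∈ D. In other words, the degree-preserving consequence over all tetravalent modal algebras coincides with the matrix consequence of the single matrix ⟨M4m, D⟩. -/

import Mathlib

/-- A tetravalent modal algebra: a bounded distributive lattice with bottom `⊥` (= 0) and
top `⊤` (= ¬0), a De Morgan negation `compl` and a modal operator `box` satisfying
`□a ⊓ ¬a = 0` and `¬□a ⊓ a = ¬a ⊓ a`. -/
class TMA (α : Type*) extends DistribLattice α, BoundedOrder α where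
  compl : α → α
  box : α → α
  compl_compl : ∀ a : α, compl (compl a) = a
  compl_sup : ∀ a b : α, compl (a ⊔ b) = compl a ⊓ compl b
  compl_bot : compl (⊥ : α) = ⊤
  box_inf_compl : ∀ a : α, box a ⊓ compl a = ⊥
  compl_box_inf : ∀ a : α, compl (box a) ⊓ a = compl a ⊓ a
/-- Formulas built from propositional variables and the constant `⊥`
by the connectives `∧`, `∨`, `¬`, `□`. -/
inductive FormulaB : Type where
  | var : ℕ → FormulaB
  | bot : FormulaB
  | and : FormulaB → FormulaB → FormulaB
  | or : FormulaB → FormulaB → FormulaB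
  | neg : FormulaB → FormulaB
  | box : FormulaB → FormulaB
deriving DecidableEq
/-- A homomorphism from the algebra of formulas to a TMA `A`: it commutes with
`∧, ∨, ¬, □` and sends `⊥` to `0`. -/
structure TMAHomB (A : Type) [TMA A] where
  toFun : FormulaB → A
  map_bot : toFun FormulaB.bot = ⊥
  map_and : ∀ φ ψ : FormulaB, toFun (φ.and ψ) = toFun φ ⊓ toFun ψ
  map_or : ∀ φ ψ : FormulaB, toFun (φ.or ψ) = toFun φ ⊔ toFun ψ
  map_neg : ∀ φ : FormulaB, toFun φ.neg = TMA.compl (toFun φ)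
  map_box : ∀ φ : FormulaB, toFun φ.box = TMA.box (toFun φ)

/-- Degree-preserving consequence over all tetravalent modal algebras:
`Γ ⊨_TML α` iff for every TMA `A` and every homomorphism `h` into `A`,
the infimum of `h '' Γ` is below `h α` (the empty infimum being `⊤ = 1`). -/
def semTML (Γ : Finset FormulaB) (α : FormulaB) : Prop :=
  ∀ (A : Type) [TMA A], ∀ h : TMAHomB A, Γ.inf h.toFun ≤ h.toFun α
/-- The four-element diamond lattice `M4 = {0, n, b, 1}`, realized as `Bool × Bool`
with `0 = (false, false)`, `n = (true, false)`, `b = (false, true)`, `1 = (true, true)`. -/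
def M4 : Type := Bool × Bool

instance : DecidableEq M4 := inferInstanceAs (DecidableEq (Bool × Bool))
instance : Fintype M4 := inferInstanceAs (Fintype (Bool × Bool))
instance : DistribLattice M4 := inferInstanceAs (DistribLattice (Bool × Bool))
instance : BoundedOrder M4 := inferInstanceAs (BoundedOrder (Bool × Bool))

/-- De Morgan negation on `M4`: `¬0 = 1`, `¬1 = 0`, `¬n = n`, `¬b = b`. -/
def m4neg (a : M4) : M4 := (!a.2, !a.1)

/-- The modal operator on `M4`: `□1 = 1` and `□0 = □n = □b = 0`. -/
def m4box (a : M4) : M4 := (a.1 && a.2, a.1 && a.2)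

/-- The designated set `D = {b, 1}` of the matrix `⟨M4m, D⟩`. -/
def m4D (a : M4) : Prop := a.2 = true
/-- `M4` with the above operations is a tetravalent modal algebra (the algebra `𝔐₄ₘ`). -/
instance : TMA M4 where
  compl := m4neg
  box := m4box
  compl_compl := by decide
  compl_sup := by decide
  compl_bot := by decide
  box_inf_compl := by decide
  compl_box_inf := by decide

namespace TMA

variable {A : Type*} [TMA A]

theorem compl_inf (a b : A) : compl (a ⊓ b) = compl a ⊔ compl b := by
  rw [← compl_compl (compl a ⊔ compl b), compl_sup, compl_compl, compl_compl]

theorem compl_box_sup (a : A) : compl (box a) ⊔ a = ⊤ := by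
  rw [← compl_bot, ← box_inf_compl a, compl_inf, compl_compl]

theorem box_sup_compl (a : A) : box a ⊔ compl a = a ⊔ compl a := by
  have h := congrArg compl (compl_box_inf a)
  rwa [compl_inf, compl_inf, compl_compl, compl_compl] at h

end TMA

theorem Order.Ideal.IsPrime.inf_mem_iff {A : Type*} [SemilatticeInf A]
    {J : Order.Ideal A} (hJ : J.IsPrime) {a b : A} :
    a ⊓ b ∈ J ↔ a ∈ J ∨ b ∈ J :=
  ⟨hJ.mem_or_mem, fun h => h.elim (J.lower inf_le_left) (J.lower inf_le_right)⟩

section PrimeIdeal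

variable {A : Type*} [TMA A] {J : Order.Ideal A}

theorem Order.Ideal.IsPrime.box_mem_iff (hJ : J.IsPrime) (a : A) :
    TMA.box a ∈ J ↔ a ∈ J ∨ TMA.compl a ∉ J := by
  have hbot : TMA.box a ∈ J ∨ TMA.compl a ∈ J :=
    hJ.inf_mem_iff.1 (TMA.box_inf_compl a ▸ J.bot_mem)
  have hsup : TMA.box a ∈ J ∧ TMA.compl a ∈ J ↔ a ∈ J ∧ TMA.compl a ∈ J := by
    rw [← Order.Ideal.sup_mem_iff, TMA.box_sup_compl, Order.Ideal.sup_mem_iff]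
  tauto

theorem Order.Ideal.IsPrime.compl_box_mem_iff (hJ : J.IsPrime) (a : A) :
    TMA.compl (TMA.box a) ∈ J ↔ a ∉ J ∧ TMA.compl a ∈ J := by
  have htop : ¬(TMA.compl (TMA.box a) ∈ J ∧ a ∈ J) := by
    rw [← Order.Ideal.sup_mem_iff, TMA.compl_box_sup]
    exact hJ.top_notMem
  have hinf : TMA.compl (TMA.box a) ∈ J ∨ a ∈ J ↔ TMA.compl a ∈ J ∨ a ∈ J := by
    rw [← hJ.inf_mem_iff, TMA.compl_box_inf, hJ.inf_mem_iff]
  tauto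

end PrimeIdeal

open Classical in
/-- The map into `M4` sending `a` to the pair of truth values of `¬a ∈ J` and `a ∉ J`. -/
noncomputable def primeIdealToM4 {A : Type*} [TMA A] (J : Order.Ideal A) (a : A) : M4 :=
  (decide (TMA.compl a ∈ J), decide (a ∉ J))

open Classical in
/-- The valuation into `M4` obtained by composing `h` with `primeIdealToM4` at a prime ideal. -/
noncomputable def TMAHomB.toM4 {A : Type} [TMA A] (h : TMAHomB A) {J : Order.Ideal A}
    (hJ : J.IsPrime) : TMAHomB M4 where
  toFun φ := primeIdealToM4 J (h.toFun φ)
  map_bot := by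
    rw [h.map_bot]
    apply Prod.ext
    · change decide _ = false
      simpa [TMA.compl_bot] using hJ.top_notMem
    · change decide _ = false
      simp
  map_and φ ψ := by
    rw [h.map_and]
    apply Prod.ext
    · change decide _ = (decide _ && decide _)
      simp [TMA.compl_inf, Order.Ideal.sup_mem_iff]
    · change decide _ = (decide _ && decide _)
      simp [hJ.inf_mem_iff]
  map_or φ ψ := by
    rw [h.map_or]
    apply Prod.ext
    · change decide _ = (decide _ || decide _)
      simp [TMA.compl_sup, hJ.inf_mem_iff]
    · change decide _ = (decide _ || decide _)
      simp [Order.Ideal.sup_mem_iff, imp_iff_not_or]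
  map_neg φ := by
    rw [h.map_neg]
    apply Prod.ext
    · change decide _ = !decide _
      simp [TMA.compl_compl]
    · change decide _ = !decide _
      simp
  map_box φ := by
    rw [h.map_box]
    apply Prod.ext
    · change decide _ = (decide _ && decide _)
      simp [hJ.compl_box_mem_iff, Bool.and_comm]
    · change decide _ = (decide _ && decide _)
      simp [hJ.box_mem_iff, Bool.and_comm]

theorem TMAHomB.m4D_toM4 {A : Type} [TMA A] (h : TMAHomB A) {J : Order.Ideal A}
    (hJ : J.IsPrime) (φ : FormulaB) : m4D ((h.toM4 hJ).toFun φ) ↔ h.toFun φ ∉ J := by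
  simp [m4D, toM4, primeIdealToM4]

theorem m4D_mono {a b : M4} (hab : a ≤ b) (ha : m4D a) : m4D b :=
  hab.2 ha

theorem m4D_finset_inf {ι : Type*} (s : Finset ι) (f : ι → M4) (hf : ∀ i ∈ s, m4D (f i)) :
    m4D (s.inf f) :=
  Finset.inf_induction (p := m4D) rfl
    (fun a ha b hb => show (a.2 && b.2) = true by rw [ha, hb]; rfl) hf

theorem tml_single_matrix (Γ : Finset FormulaB) (α : FormulaB) :
    semTML Γ α ↔
      ∀ v : TMAHomB M4, (∀ γ ∈ Γ, m4D (v.toFun γ)) → m4D (v.toFun α) := by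
  constructor
  · intro h v hv
    exact m4D_mono (h M4 v) (m4D_finset_inf Γ v.toFun hv)
  · intro hm A _ h
    by_contra hle
    have hdisj : Disjoint (Order.PFilter.principal (Γ.inf h.toFun) : Set A)
        (Order.Ideal.principal (h.toFun α)) :=
      Set.disjoint_left.2 fun a hF hI =>
        hle (le_trans (Order.PFilter.mem_principal.1 hF) (Order.Ideal.mem_principal.1 hI))
    obtain ⟨J, hJ, hIJ, hFJ⟩ := DistribLattice.prime_ideal_of_disjoint_filter_ideal hdisj
    have hΓ : Γ.inf h.toFun ∉ J :=
      Set.disjoint_left.1 hFJ (Order.PFilter.mem_principal.2 le_rfl)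
    have hα : h.toFun α ∈ J := hIJ (Order.Ideal.mem_principal_self)
    refine (h.m4D_toM4 hJ α).1 (hm (h.toM4 hJ) fun γ hγ => ?_) hα
    exact (h.m4D_toM4 hJ γ).2 fun hγJ => hΓ (J.lower (Finset.inf_le hγ) hγJ)
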